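/- arXiv:1811.00618 — 3 statements merged into one kernel-verified Lean document; each statement's English description precedes it below -/
import Mathlib

section
/- Let p₁(·), p₂(·) : ℝⁿ → [1,∞) satisfy 1 < (pⱼ)₋ ≤ (pⱼ)₊ < ∞ and pⱼ(·) ∈ LH for j = 1,2, define p(·) by 1/p = 1/p₁ + 1/p₂, let w₁, w₂ be weights with w = w₁w₂ and (w₁,w₂,w) ∈ A_{p⃗(·)}. For a cube Q, let q(Q) be defined by 1/q(Q) = 1/(p₁)₋(Q) + 1/(p₂)₋(Q). Then for l = 1,2 there is a constant C independent of Q such that for every cube Q and a.e. x ∈ Q, ‖wₗ^{−1}χ_Q‖_{pₗ'(·)}^{q(Q)−p(x)} ≤ C. -/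
open MeasureTheory ENNReal Set

noncomputable section

/-- Euclidean space `ℝⁿ`. -/
abbrev Rn (n : ℕ) : Type := Fin n → ℝ

/-- A cube in `ℝⁿ` with sides parallel to the coordinate axes. -/
structure Cube (n : ℕ) : Type where
  base : Fin n → ℝ
  side : ℝ
  side_pos : 0 < side

namespace Cube

/-- The set of points of a cube. -/
def toSet {n : ℕ} (Q : Cube n) : Set (Rn n) :=
  {x | ∀ i, Q.base i ≤ x i ∧ x i < Q.base i + Q.side}

/-- The volume `|Q|` of a cube. -/
def vol {n : ℕ} (Q : Cube n) : ℝ≥0∞ := ENNReal.ofReal (Q.side ^ n)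

/-- Membership in the standard dyadic grid `𝒟₀`. -/
def IsDyadic {n : ℕ} (Q : Cube n) : Prop :=
  ∃ (k : ℤ) (j : Fin n → ℤ), Q.side = (2 : ℝ) ^ (-k) ∧
    ∀ i, Q.base i = (2 : ℝ) ^ (-k) * (j i : ℝ)

end Cube

/-- The modular associated to an extended-real-valued exponent `r(·)`:
`ρ(f/λ) = ∫_{r ≠ ∞} (f/λ)^{r(x)} dμ + ‖f/λ‖_{L^∞({r = ∞})}`. -/
def eModular {n : ℕ} (r : Rn n → ℝ≥0∞) (μ : Measure (Rn n)) (f : Rn n → ℝ≥0∞)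
    (lam : ℝ≥0∞) : ℝ≥0∞ :=
  (∫⁻ x in {x | r x ≠ ∞}, (f x / lam) ^ (r x).toReal ∂μ)
    + essSup (fun x => f x / lam) (μ.restrict {x | r x = ∞})

/-- The variable Lebesgue (quasi)norm `‖f‖_{r(·)}` with respect to a measure `μ`. -/
def eNorm {n : ℕ} (r : Rn n → ℝ≥0∞) (μ : Measure (Rn n)) (f : Rn n → ℝ≥0∞) : ℝ≥0∞ :=
  sInf {lam : ℝ≥0∞ | lam ≠ 0 ∧ eModular r μ f lam ≤ 1}

/-- The variable Lebesgue norm of a real-valued function with respect to Lebesgue measure. -/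
def vNorm {n : ℕ} (r : Rn n → ℝ≥0∞) (f : Rn n → ℝ) : ℝ≥0∞ :=
  eNorm r volume fun x => ENNReal.ofReal |f x|

/-- View a real-valued exponent as an extended-real-valued one. -/
def ofExp {n : ℕ} (p : Rn n → ℝ) : Rn n → ℝ≥0∞ := fun x => ENNReal.ofReal (p x)

/-- The conjugate of an extended real exponent: `1/t + 1/t' = 1`. -/
def econj (t : ℝ≥0∞) : ℝ≥0∞ :=
  if t = 1 then ∞ else if t = ∞ then 1 else ENNReal.ofReal (t.toReal / (t.toReal - 1))

/-- The pointwise conjugate exponent `p'(·)` of a real-valued exponent. -/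
def conjExp {n : ℕ} (p : Rn n → ℝ) : Rn n → ℝ≥0∞ := fun x => econj (ENNReal.ofReal (p x))

/-- A weight: a measurable function that is positive (and finite) a.e. -/
def IsWeight {n : ℕ} (w : Rn n → ℝ) : Prop :=
  Measurable w ∧ ∀ᵐ x ∂(volume : Measure (Rn n)), 0 < w x

/-- Local log-Hölder continuity `LH₀`. -/
def LH0 {n : ℕ} (p : Rn n → ℝ) : Prop :=
  ∃ C₀ > 0, ∀ x y : Rn n, dist x y < 1 / 2 →
    |1 / p x - 1 / p y| ≤ C₀ / (-Real.log (dist x y))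

/-- Log-Hölder continuity at infinity with a given asymptotic value `pinf`. -/
def LHinfWith {n : ℕ} (p : Rn n → ℝ) (pinf : ℝ) : Prop :=
  ∃ C > 0, ∀ x : Rn n, |1 / p x - 1 / pinf| ≤ C / Real.log (Real.exp 1 + ‖x‖)

/-- Log-Hölder continuity at infinity `LH∞`. -/
def LHinf {n : ℕ} (p : Rn n → ℝ) : Prop := ∃ pinf > 0, LHinfWith p pinf

/-- Log-Hölder continuity `LH = LH₀ ∩ LH∞`. -/
def LH {n : ℕ} (p : Rn n → ℝ) : Prop := LH0 p ∧ LHinf p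

/-- The bilinear variable Muckenhoupt condition `(w₁,w₂,w) ∈ A_{p⃗(·)}`. -/
def ApVec {n : ℕ} (p₁ p₂ p w₁ w₂ w : Rn n → ℝ) : Prop :=
  ∃ C : ℝ≥0∞, C ≠ ∞ ∧ ∀ Q : Cube n,
    Q.vol⁻¹ ^ 2 * vNorm (ofExp p) (Q.toSet.indicator w) *
      vNorm (conjExp p₁) (Q.toSet.indicator fun x => (w₁ x)⁻¹) *
      vNorm (conjExp p₂) (Q.toSet.indicator fun x => (w₂ x)⁻¹) ≤ C

/-- The variable Muckenhoupt class `A_{r(·)}` for an extended-real-valued exponent. -/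
def ApVarE {n : ℕ} (r : Rn n → ℝ≥0∞) (v : Rn n → ℝ) : Prop :=
  ∃ C : ℝ≥0∞, C ≠ ∞ ∧ ∀ Q : Cube n,
    Q.vol⁻¹ * vNorm r (Q.toSet.indicator v) *
      vNorm (fun x => econj (r x)) (Q.toSet.indicator fun x => (v x)⁻¹) ≤ C

/-- The bilinear maximal operator `M(f₁,f₂)`. -/
def biMax {n : ℕ} (f₁ f₂ : Rn n → ℝ) (x : Rn n) : ℝ≥0∞ :=
  ⨆ (Q : Cube n) (_ : x ∈ Q.toSet),
    (Q.vol⁻¹ * ∫⁻ y in Q.toSet, ENNReal.ofReal |f₁ y|) *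
      (Q.vol⁻¹ * ∫⁻ y in Q.toSet, ENNReal.ofReal |f₂ y|)

/-- The dyadic bilinear maximal operator `M^d(f₁,f₂)`. -/
def biMaxD {n : ℕ} (f₁ f₂ : Rn n → ℝ) (x : Rn n) : ℝ≥0∞ :=
  ⨆ (Q : Cube n) (_ : Q.IsDyadic) (_ : x ∈ Q.toSet),
    (Q.vol⁻¹ * ∫⁻ y in Q.toSet, ENNReal.ofReal |f₁ y|) *
      (Q.vol⁻¹ * ∫⁻ y in Q.toSet, ENNReal.ofReal |f₂ y|)

/-- The bilinear averaging operator `A_Q(f₁,f₂) = (⨍_Q f₁)(⨍_Q f₂)χ_Q`. -/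
def avgOp {n : ℕ} (Q : Cube n) (f₁ f₂ : Rn n → ℝ) (x : Rn n) : ℝ≥0∞ :=
  Q.toSet.indicator
    (fun _ =>
      (Q.vol⁻¹ * ∫⁻ y in Q.toSet, ENNReal.ofReal |f₁ y|) *
        (Q.vol⁻¹ * ∫⁻ y in Q.toSet, ENNReal.ofReal |f₂ y|)) x

/-- `(p)₋(Q)`, the essential infimum of `p` on a cube `Q`. -/
def pMinusOn {n : ℕ} (p : Rn n → ℝ) (Q : Cube n) : ℝ :=
  essInf p (volume.restrict Q.toSet)

/-- The exponent `q(Q)` with `1/q(Q) = 1/(p₁)₋(Q) + 1/(p₂)₋(Q)`. -/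
def qExp {n : ℕ} (p₁ p₂ : Rn n → ℝ) (Q : Cube n) : ℝ :=
  ((pMinusOn p₁ Q)⁻¹ + (pMinusOn p₂ Q)⁻¹)⁻¹

theorem Cube.toSet_eq_pi {n : ℕ} (Q : Cube n) :
    Q.toSet = Set.univ.pi fun i => Set.Ico (Q.base i) (Q.base i + Q.side) := by
  ext x
  simp [Cube.toSet]

theorem Cube.measurableSet_toSet {n : ℕ} (Q : Cube n) : MeasurableSet Q.toSet := by
  rw [Q.toSet_eq_pi]
  exact MeasurableSet.univ_pi fun _ => measurableSet_Ico

theorem Cube.volume_toSet {n : ℕ} (Q : Cube n) : volume Q.toSet = Q.vol := by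
  rw [Q.toSet_eq_pi, Real.volume_pi_Ico]
  simp [Cube.vol, ENNReal.ofReal_pow Q.side_pos.le]

theorem Cube.vol_ne_zero {n : ℕ} (Q : Cube n) : Q.vol ≠ 0 := by
  have := Q.side_pos
  simp only [Cube.vol, ne_eq, ENNReal.ofReal_eq_zero, not_le]
  positivity

theorem Cube.vol_ne_top {n : ℕ} (Q : Cube n) : Q.vol ≠ ∞ := ENNReal.ofReal_ne_top

/-- If the exponent is a.e. finite, only the integral part of the modular survives. -/
theorem eModular_of_ae_ne_top {n : ℕ} {r : Rn n → ℝ≥0∞} {μ : Measure (Rn n)}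
    (hr : ∀ᵐ x ∂μ, r x ≠ ∞) (f : Rn n → ℝ≥0∞) (lam : ℝ≥0∞) :
    eModular r μ f lam = ∫⁻ x, (f x / lam) ^ (r x).toReal ∂μ := by
  have h0 : μ.restrict {x | r x = ∞} = 0 := by
    rw [Measure.restrict_eq_zero]
    simpa [ae_iff] using hr
  have h1 : μ.restrict {x | r x ≠ ∞} = μ :=
    Measure.restrict_eq_self_of_ae_mem hr
  rw [eModular, h0, h1, essSup_measure_zero]
  simp

theorem vNorm_indicator_mono {n : ℕ} (r : Rn n → ℝ≥0∞) (f : Rn n → ℝ) {S T : Set (Rn n)}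
    (h : S ⊆ T) : vNorm r (S.indicator f) ≤ vNorm r (T.indicator f) := by
  have key : ∀ x, ENNReal.ofReal |S.indicator f x| ≤ ENNReal.ofReal |T.indicator f x| := by
    intro x
    by_cases hx : x ∈ S
    · simp [hx, h hx]
    · simp [hx]
  refine sInf_le_sInf fun lam hlam => ⟨hlam.1, le_trans ?_ hlam.2⟩
  refine add_le_add (lintegral_mono fun x => ?_)
    (essSup_mono_ae (Filter.Eventually.of_forall fun x => ?_))
  · exact ENNReal.rpow_le_rpow (ENNReal.div_le_div_right (key x) _) ENNReal.toReal_nonneg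
  · exact ENNReal.div_le_div_right (key x) _

/-- The norm of a function that vanishes at most on a null subset of a cube is nonzero. -/
theorem vNorm_indicator_ne_zero {n : ℕ} {r : Rn n → ℝ≥0∞} (hrm : Measurable r)
    (hr : ∀ᵐ x, r x ≠ ∞) (hr' : ∀ᵐ x, 1 / 2 ≤ (r x).toReal) {f : Rn n → ℝ}
    (hf : Measurable f) (hf0 : ∀ᵐ x, f x ≠ 0) (Q : Cube n) :
    vNorm r (Q.toSet.indicator f) ≠ 0 := by
  set g : Rn n → ℝ≥0∞ := fun x => ENNReal.ofReal |Q.toSet.indicator f x| with hg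
  have hgm : Measurable g := (hf.indicator Q.measurableSet_toSet).abs.ennreal_ofReal
  set J := ∫⁻ x, g x ^ (r x).toReal with hJ
  have hJ0 : J ≠ 0 := by
    intro h
    rw [hJ, lintegral_eq_zero_iff (hgm.pow hrm.ennreal_toReal)] at h
    have hnull : volume Q.toSet = 0 := by
      refine measure_mono_null (fun x hx => ?_)
        (ae_iff.1 ((h.and hf0).and hr') : volume _ = 0)
      rintro ⟨⟨h1, h2⟩, h3⟩
      have h4 : (r x).toReal > 0 := by linarith
      simp [hg, hx, h2, ENNReal.rpow_eq_zero_iff, h4, h4.not_gt] at h1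
    exact Q.vol_ne_zero (Q.volume_toSet ▸ hnull)
  have hle : min 1 (J ^ (2 : ℝ)) ≤ vNorm r (Q.toSet.indicator f) := by
    refine le_sInf fun lam hlam => ?_
    obtain ⟨hlam0, hmod⟩ := hlam
    rcases le_or_gt 1 lam with h1 | h1
    · exact (min_le_left _ _).trans h1
    refine (min_le_right _ _).trans ?_
    have hlamt : lam ≠ ∞ := (h1.trans one_lt_top).ne
    rw [eModular_of_ae_ne_top hr] at hmod
    have : J ≤ lam ^ (1 / 2 : ℝ) := by
      calc J ≤ ∫⁻ x, lam ^ (1 / 2 : ℝ) * (g x / lam) ^ (r x).toReal := by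
            refine lintegral_mono_ae ?_
            filter_upwards [hr'] with x hx
            rw [ENNReal.div_rpow_of_nonneg _ _ ENNReal.toReal_nonneg, ← mul_div_assoc,
              mul_comm, mul_div_assoc]
            refine le_mul_of_one_le_right' ?_
            rw [ENNReal.le_div_iff_mul_le (Or.inl ?_) (Or.inl ?_), one_mul]
            · exact ENNReal.rpow_le_rpow_of_exponent_ge h1.le hx
            · simp [ENNReal.rpow_eq_zero_iff, hlam0, hlamt]
            · exact ENNReal.rpow_ne_top_of_nonneg ENNReal.toReal_nonneg hlamt
        _ = lam ^ (1 / 2 : ℝ) * ∫⁻ x, (g x / lam) ^ (r x).toReal :=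
            lintegral_const_mul _ ((hgm.div_const _).pow hrm.ennreal_toReal)
        _ ≤ lam ^ (1 / 2 : ℝ) := mul_le_of_le_one_right' hmod
    calc J ^ (2 : ℝ) ≤ (lam ^ (1 / 2 : ℝ)) ^ (2 : ℝ) := ENNReal.rpow_le_rpow this (by norm_num)
      _ = lam := by rw [← ENNReal.rpow_mul]; norm_num
  intro h
  rw [h] at hle
  have h2 : min 1 (J ^ (2 : ℝ)) = 0 := le_antisymm hle bot_le
  rcases min_eq_iff.1 h2 with h3 | h3
  · exact one_ne_zero h3.1
  · exact hJ0 (by simpa using h3.1)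

theorem le_sInf_mul_of_forall_le_mul {S : Set ℝ≥0∞} {c k : ℝ≥0∞} (hk : k ≠ 0)
    (hS : sInf S ≠ 0) (h : ∀ a ∈ S, c ≤ a * k) : c ≤ sInf S * k := by
  rcases eq_or_ne k ∞ with rfl | hkt
  · simp [ENNReal.mul_top hS]
  · rw [← ENNReal.div_le_iff hk hkt]
    exact le_sInf fun a ha => ENNReal.div_le_of_le_mul (h a ha)

/-- A crude three-factor Young inequality. -/
theorem rpow_half_mul_le_add {a b d : ℝ≥0∞} {r s t : ℝ} (hr : 0 < r) (hs : 0 < s) (ht : 0 < t)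
    (h : 1 / r + 1 / s + 1 / t = 2) :
    (a * b * d) ^ (1 / 2 : ℝ) ≤ a ^ r + b ^ s + d ^ t := by
  set M := a ^ r + b ^ s + d ^ t with hM
  have aux : ∀ {y : ℝ≥0∞} {u : ℝ}, 0 < u → y ^ u ≤ M → y ^ (1 / 2 : ℝ) ≤ M ^ (1 / (2 * u)) := by
    intro y u hu hy
    calc y ^ (1 / 2 : ℝ) = (y ^ u) ^ (1 / (2 * u)) := by
          rw [← ENNReal.rpow_mul]; congr 1; field_simp
      _ ≤ _ := ENNReal.rpow_le_rpow hy (by positivity)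
  have ha : a ^ r ≤ M := le_add_right le_self_add
  have hb : b ^ s ≤ M := le_add_right le_add_self
  have hd : d ^ t ≤ M := le_add_self
  calc (a * b * d) ^ (1 / 2 : ℝ) = a ^ (1 / 2 : ℝ) * b ^ (1 / 2 : ℝ) * d ^ (1 / 2 : ℝ) := by
        rw [ENNReal.mul_rpow_of_nonneg _ _ (by norm_num),
          ENNReal.mul_rpow_of_nonneg _ _ (by norm_num)]
    _ ≤ M ^ (1 / (2 * r)) * M ^ (1 / (2 * s)) * M ^ (1 / (2 * t)) := by
        gcongr
        exacts [aux hr ha, aux hs hb, aux ht hd]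
    _ = M ^ (1 : ℝ) := by
        rw [← ENNReal.rpow_add_of_nonneg _ _ (by positivity) (by positivity),
          ← ENNReal.rpow_add_of_nonneg _ _ (by positivity) (by positivity)]
        congr 1
        have : 1 / (2 * r) + 1 / (2 * s) + 1 / (2 * t) = (1 / r + 1 / s + 1 / t) / 2 := by
          field_simp
        rw [this, h]; norm_num
    _ = M := ENNReal.rpow_one _

/-- Three-factor Hölder inequality for square roots on a cube. -/
theorem vol_sq_le_vNorm_mul {n : ℕ} {r₁ r₂ r₃ : Rn n → ℝ≥0∞} {f₁ f₂ f₃ : Rn n → ℝ}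
    (hm₁ : Measurable r₁) (hm₂ : Measurable r₂)
    (hf₁ : Measurable f₁) (hf₂ : Measurable f₂)
    (ht₁ : ∀ᵐ x, r₁ x ≠ ∞) (ht₂ : ∀ᵐ x, r₂ x ≠ ∞) (ht₃ : ∀ᵐ x, r₃ x ≠ ∞)
    (hp₁ : ∀ᵐ x, 0 < (r₁ x).toReal) (hp₂ : ∀ᵐ x, 0 < (r₂ x).toReal)
    (hp₃ : ∀ᵐ x, 0 < (r₃ x).toReal)
    (hr : ∀ᵐ x, 1 / (r₁ x).toReal + 1 / (r₂ x).toReal + 1 / (r₃ x).toReal = 2)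
    (hf : ∀ᵐ x, f₁ x * f₂ x * f₃ x = 1) (Q : Cube n)
    (hN₁ : vNorm r₁ (Q.toSet.indicator f₁) ≠ 0) (hN₂ : vNorm r₂ (Q.toSet.indicator f₂) ≠ 0)
    (hN₃ : vNorm r₃ (Q.toSet.indicator f₃) ≠ 0) :
    Q.vol ^ 2 ≤ 9 * (vNorm r₁ (Q.toSet.indicator f₁) * vNorm r₂ (Q.toSet.indicator f₂) *
      vNorm r₃ (Q.toSet.indicator f₃)) := by
  have main : ∀ a b d : ℝ≥0∞, a ≠ 0 → b ≠ 0 → d ≠ 0 →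
      eModular r₁ volume (fun x => ENNReal.ofReal |Q.toSet.indicator f₁ x|) a ≤ 1 →
      eModular r₂ volume (fun x => ENNReal.ofReal |Q.toSet.indicator f₂ x|) b ≤ 1 →
      eModular r₃ volume (fun x => ENNReal.ofReal |Q.toSet.indicator f₃ x|) d ≤ 1 →
      Q.vol ^ 2 ≤ 9 * (a * b * d) := by
    intro a b d ha hb hd hA hB hD
    rw [eModular_of_ae_ne_top ‹_›] at hA hB hD
    set K := a * b * d with hK
    have hK0 : K ≠ 0 := by simp [hK, ha, hb, hd]
    rcases eq_or_ne K ∞ with hKt | hKt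
    · simp [hKt]
    have restr : ∀ (r : Rn n → ℝ≥0∞) (f : Rn n → ℝ) (lam : ℝ≥0∞),
        ∫⁻ x, (ENNReal.ofReal |Q.toSet.indicator f x| / lam) ^ (r x).toReal ≤ 1 →
        ∫⁻ x in Q.toSet, (ENNReal.ofReal |f x| / lam) ^ (r x).toReal ≤ 1 := by
      intro r f lam h
      refine le_trans (le_of_eq ?_) ((setLIntegral_le_lintegral Q.toSet _).trans h)
      refine setLIntegral_congr_fun Q.measurableSet_toSet fun x hx => ?_
      simp [hx]
    have h3 : Q.vol / K ^ (1 / 2 : ℝ) ≤ 3 := by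
      calc Q.vol / K ^ (1 / 2 : ℝ) = ∫⁻ x in Q.toSet, (K⁻¹) ^ (1 / 2 : ℝ) := by
            rw [setLIntegral_const, Q.volume_toSet, ENNReal.inv_rpow, div_eq_mul_inv, mul_comm]
        _ ≤ ∫⁻ x in Q.toSet, ((ENNReal.ofReal |f₁ x| / a) ^ (r₁ x).toReal +
              (ENNReal.ofReal |f₂ x| / b) ^ (r₂ x).toReal +
              (ENNReal.ofReal |f₃ x| / d) ^ (r₃ x).toReal) := by
            refine lintegral_mono_ae (ae_restrict_of_ae ?_)
            filter_upwards [hp₁, hp₂, hp₃, hr, hf] with x h1 h2 h3 h4 h5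
            refine le_trans (le_of_eq ?_) (rpow_half_mul_le_add h1 h2 h3 h4)
            congr 1
            have h6 : ENNReal.ofReal |f₁ x| * ENNReal.ofReal |f₂ x| * ENNReal.ofReal |f₃ x| = 1 := by
              rw [← ENNReal.ofReal_mul (abs_nonneg _), ← abs_mul,
                ← ENNReal.ofReal_mul (abs_nonneg _), ← abs_mul, h5]
              simp
            rw [hK, ENNReal.mul_inv (Or.inl (mul_ne_zero ha hb)) (Or.inr hd),
              ENNReal.mul_inv (Or.inl ha) (Or.inr hb), div_eq_mul_inv, div_eq_mul_inv,
              div_eq_mul_inv, mul_mul_mul_comm _ a⁻¹, mul_mul_mul_comm _ (a⁻¹ * b⁻¹), h6, one_mul]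
        _ = (∫⁻ x in Q.toSet, (ENNReal.ofReal |f₁ x| / a) ^ (r₁ x).toReal) +
              (∫⁻ x in Q.toSet, (ENNReal.ofReal |f₂ x| / b) ^ (r₂ x).toReal) +
              (∫⁻ x in Q.toSet, (ENNReal.ofReal |f₃ x| / d) ^ (r₃ x).toReal) := by
            have m₁ : Measurable fun x => (ENNReal.ofReal |f₁ x| / a) ^ (r₁ x).toReal :=
              (hf₁.abs.ennreal_ofReal.div_const _).pow hm₁.ennreal_toReal
            have m₂ : Measurable fun x => (ENNReal.ofReal |f₂ x| / b) ^ (r₂ x).toReal :=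
              (hf₂.abs.ennreal_ofReal.div_const _).pow hm₂.ennreal_toReal
            have m₁₂ : Measurable fun x => (ENNReal.ofReal |f₁ x| / a) ^ (r₁ x).toReal +
                (ENNReal.ofReal |f₂ x| / b) ^ (r₂ x).toReal := m₁.add m₂
            rw [lintegral_add_left m₁₂, lintegral_add_left m₁]
        _ ≤ 1 + 1 + 1 :=
            add_le_add (add_le_add (restr _ _ _ hA) (restr _ _ _ hB)) (restr _ _ _ hD)
        _ = 3 := by norm_num
    rw [ENNReal.div_le_iff (by simp [ENNReal.rpow_eq_zero_iff, hK0, hKt])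
      (ENNReal.rpow_ne_top_of_nonneg (by norm_num) hKt)] at h3
    calc Q.vol ^ 2 ≤ (3 * K ^ (1 / 2 : ℝ)) ^ 2 := by gcongr
      _ = 9 * K := by
        rw [mul_pow, ← ENNReal.rpow_natCast (K ^ (1 / 2 : ℝ)), ← ENNReal.rpow_mul]
        norm_num
  have s3 : ∀ a b : ℝ≥0∞, a ≠ 0 → b ≠ 0 →
      eModular r₁ volume (fun x => ENNReal.ofReal |Q.toSet.indicator f₁ x|) a ≤ 1 →
      eModular r₂ volume (fun x => ENNReal.ofReal |Q.toSet.indicator f₂ x|) b ≤ 1 →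
      Q.vol ^ 2 ≤ vNorm r₃ (Q.toSet.indicator f₃) * (9 * (a * b)) := by
    intro a b ha hb hA hB
    refine le_sInf_mul_of_forall_le_mul (by simp [ha, hb]) hN₃ fun d hd => ?_
    exact (main a b d ha hb hd.1 hA hB hd.2).trans_eq (by ring)
  have s2 : ∀ a : ℝ≥0∞, a ≠ 0 →
      eModular r₁ volume (fun x => ENNReal.ofReal |Q.toSet.indicator f₁ x|) a ≤ 1 →
      Q.vol ^ 2 ≤ vNorm r₂ (Q.toSet.indicator f₂) *
        (9 * (a * vNorm r₃ (Q.toSet.indicator f₃))) := by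
    intro a ha hA
    refine le_sInf_mul_of_forall_le_mul (by simp [ha, hN₃]) hN₂ fun b hb => ?_
    exact (s3 a b ha hb.1 hA hb.2).trans_eq (by ring)
  have s1 : Q.vol ^ 2 ≤ vNorm r₁ (Q.toSet.indicator f₁) *
      (9 * (vNorm r₂ (Q.toSet.indicator f₂) * vNorm r₃ (Q.toSet.indicator f₃))) := by
    refine le_sInf_mul_of_forall_le_mul (by simp [hN₂, hN₃]) hN₁ fun a ha => ?_
    exact (s2 a ha.1 ha.2).trans_eq (by ring)
  exact s1.trans_eq (by ring)

theorem measurable_econj : Measurable econj := by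
  unfold econj
  refine Measurable.ite (measurableSet_singleton _) measurable_const
    (Measurable.ite (measurableSet_singleton _) measurable_const ?_)
  fun_prop

theorem measurable_conjExp {n : ℕ} {p : Rn n → ℝ} (hp : Measurable p) :
    Measurable (conjExp p) :=
  measurable_econj.comp hp.ennreal_ofReal

theorem conjExp_of_one_lt {n : ℕ} {p : Rn n → ℝ} {x : Rn n} (h : 1 < p x) :
    conjExp p x = ENNReal.ofReal (p x / (p x - 1)) := by
  have h1 : ENNReal.ofReal (p x) ≠ 1 := by
    rw [ne_eq, ENNReal.ofReal_eq_one]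
    exact h.ne'
  simp [conjExp, econj, h1, ENNReal.toReal_ofReal (zero_le_one.trans h.le)]

theorem toReal_conjExp_of_one_lt {n : ℕ} {p : Rn n → ℝ} {x : Rn n} (h : 1 < p x) :
    (conjExp p x).toReal = p x / (p x - 1) := by
  rw [conjExp_of_one_lt h, ENNReal.toReal_ofReal]
  exact div_nonneg (by linarith) (by linarith)

/-- A cube that contains both `Q` and the unit cube `[0,1)ⁿ`. -/
def Cube.hull {n : ℕ} (Q : Cube n) : Cube n where
  base := fun _ => -(‖Q.base‖ + Q.side + 1)
  side := 2 * (‖Q.base‖ + Q.side + 1)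
  side_pos := by
    have := Q.side_pos
    positivity

theorem Cube.toSet_subset_hull {n : ℕ} (Q : Cube n) : Q.toSet ⊆ Q.hull.toSet := by
  intro x hx i
  have h1 := abs_le.1 (norm_le_pi_norm Q.base i)
  have h2 := hx i
  have h3 := Q.side_pos
  simp only [Cube.hull]
  constructor <;> linarith

/-- The unit cube `[0,1)ⁿ`. -/
def Cube.unit (n : ℕ) : Cube n := ⟨0, 1, one_pos⟩

theorem Cube.unit_subset_hull {n : ℕ} (Q : Cube n) : (Cube.unit n).toSet ⊆ Q.hull.toSet := by
  intro x hx i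
  have h1 := norm_nonneg Q.base
  have h2 := hx i
  have h3 := Q.side_pos
  simp only [Cube.hull, Cube.unit, Pi.zero_apply] at h2 ⊢
  constructor <;> linarith

theorem Cube.dist_lt_side {n : ℕ} {Q : Cube n} {x y : Rn n} (hx : x ∈ Q.toSet)
    (hy : y ∈ Q.toSet) : dist x y < Q.side := by
  rw [dist_pi_lt_iff Q.side_pos]
  intro i
  have h1 := hx i
  have h2 := hy i
  rw [Real.dist_eq, abs_lt]
  constructor <;> linarith

theorem Cube.norm_base_le {n : ℕ} {Q : Cube n} {x : Rn n} (hx : x ∈ Q.toSet) :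
    ‖Q.base‖ ≤ ‖x‖ + Q.side := by
  have hb : Q.base ∈ Q.toSet := fun i => ⟨le_rfl, by linarith [Q.side_pos]⟩
  have h := Cube.dist_lt_side hb hx
  rw [dist_eq_norm] at h
  have := norm_le_norm_add_norm_sub' Q.base x
  linarith

/-- Log-Hölder continuity controls the oscillation of `1/p` on a cube by the reciprocal of
`log (ℓ(Q̃)/ℓ(Q))`, where `Q̃` is the hull of `Q` and the unit cube. -/
theorem LH.exists_osc_mul_log_le {n : ℕ} {p : Rn n → ℝ} (hp1 : ∀ x, 1 ≤ p x) (hp : LH p) :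
    ∃ K : ℝ, 0 ≤ K ∧ ∀ Q : Cube n, ∀ x ∈ Q.toSet, ∀ y ∈ Q.toSet,
      |1 / p x - 1 / p y| * Real.log (Q.hull.side / Q.side) ≤ K := by
  obtain ⟨⟨C₀, hC₀, h0⟩, pinf, -, C, hC, hinf⟩ := hp
  refine ⟨8 * C + C₀ + 9, by positivity, fun Q x hx y hy => ?_⟩
  have hs := Q.side_pos
  have hb := norm_nonneg Q.base
  set d := |1 / p x - 1 / p y| with hd
  have hd0 : 0 ≤ d := abs_nonneg _
  have hd1 : d ≤ 1 := by
    have h1 : ∀ z, 0 ≤ 1 / p z ∧ 1 / p z ≤ 1 := fun z =>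
      ⟨by have := hp1 z; positivity, by
        rw [div_le_one (by linarith [hp1 z])]; exact hp1 z⟩
    rw [hd, abs_le]
    constructor <;> linarith [h1 x, h1 y]
  have he : (2 : ℝ) ≤ Real.exp 1 := by linarith [Real.add_one_le_exp (1 : ℝ)]
  have hl : ∀ z : Rn n, 1 ≤ Real.log (Real.exp 1 + ‖z‖) := fun z => by
    rw [Real.le_log_iff_exp_le (by positivity)]
    linarith [norm_nonneg z]
  have far : ∀ T k : ℝ, 0 ≤ k → (∀ z ∈ Q.toSet, T ≤ k * Real.log (Real.exp 1 + ‖z‖)) →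
      d * T ≤ 2 * C * k := by
    intro T k hk hT
    have one : ∀ z ∈ Q.toSet, |1 / p z - 1 / pinf| * T ≤ C * k := by
      intro z hz
      have hz1 := hl z
      calc |1 / p z - 1 / pinf| * T
          ≤ |1 / p z - 1 / pinf| * (k * Real.log (Real.exp 1 + ‖z‖)) :=
            mul_le_mul_of_nonneg_left (hT z hz) (abs_nonneg _)
        _ ≤ C / Real.log (Real.exp 1 + ‖z‖) * (k * Real.log (Real.exp 1 + ‖z‖)) :=
            mul_le_mul_of_nonneg_right (hinf z) (by positivity)
        _ = C * k := by field_simp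
    rcases le_or_gt 0 T with h | h
    · have tri : d ≤ |1 / p x - 1 / pinf| + |1 / p y - 1 / pinf| := by
        rw [abs_sub_comm (1 / p y)]
        exact abs_sub_le _ _ _
      calc d * T ≤ (|1 / p x - 1 / pinf| + |1 / p y - 1 / pinf|) * T := by gcongr
        _ ≤ 2 * C * k := by linarith [one x hx, one y hy]
    · have : d * T ≤ 0 := mul_nonpos_of_nonneg_of_nonpos hd0 h.le
      have : 0 ≤ 2 * C * k := by positivity
      linarith
  have hL : Q.hull.side = 2 * (‖Q.base‖ + Q.side + 1) := rfl
  have hL0 := Q.hull.side_pos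
  rcases lt_or_ge Q.side (1 / 2) with hs2 | hs2
  · have h1 : d * Real.log Q.hull.side ≤ 2 * C * 2 := by
      refine far _ _ (by norm_num) fun z hz => ?_
      have hz0 := norm_nonneg z
      have := Cube.norm_base_le hz
      rw [show (2 : ℝ) = ((2 : ℕ) : ℝ) by norm_num, ← Real.log_pow]
      refine Real.log_le_log hL0 ?_
      rw [hL]
      nlinarith
    have h2 : d * -Real.log Q.side ≤ C₀ := by
      rcases eq_or_ne x y with rfl | hxy
      · simp [hd, hC₀.le]
      have hdist := dist_pos.2 hxy
      have hlt := Cube.dist_lt_side hx hy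
      have h3 := h0 x y (hlt.trans hs2)
      have h4 : Real.log (dist x y) < 0 := Real.log_neg hdist (by linarith)
      rw [le_div_iff₀ (by linarith)] at h3
      refine le_trans ?_ h3
      have := Real.log_le_log hdist hlt.le
      exact mul_le_mul_of_nonneg_left (by linarith) hd0
    rw [Real.log_div hL0.ne' hs.ne']
    linarith
  · rcases le_or_gt ‖Q.base‖ (2 * Q.side) with hb2 | hb2
    · have h1 : Real.log (Q.hull.side / Q.side) ≤ 9 := by
        have h2 : Q.hull.side / Q.side ≤ 10 := by
          rw [div_le_iff₀ hs, hL]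
          linarith
        linarith [Real.log_le_sub_one_of_pos (div_pos hL0 hs)]
      have h3 : d * Real.log (Q.hull.side / Q.side) ≤ d * 9 := by gcongr
      linarith
    · have h1 : d * Real.log (Q.hull.side / Q.side) ≤ 2 * C * 4 := by
        refine far _ _ (by norm_num) fun z hz => ?_
        have hz0 := norm_nonneg z
        have := Cube.norm_base_le hz
        rw [show (4 : ℝ) = ((4 : ℕ) : ℝ) by norm_num, ← Real.log_pow]
        refine Real.log_le_log (div_pos hL0 hs) ?_
        have h2 : Q.hull.side / Q.side ≤ 8 * (Real.exp 1 + ‖z‖) := by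
          rw [div_le_iff₀ hs, hL]
          nlinarith
        have h3 : (2 : ℝ) ^ 3 ≤ (Real.exp 1 + ‖z‖) ^ 3 := by gcongr; linarith
        have h4 : 0 ≤ Real.exp 1 + ‖z‖ := by linarith
        nlinarith
      linarith

theorem Cube.restrict_ne_zero {n : ℕ} (Q : Cube n) :
    (volume : Measure (Rn n)).restrict Q.toSet ≠ 0 := by
  rw [ne_eq, Measure.restrict_eq_zero, Q.volume_toSet]
  exact Q.vol_ne_zero

theorem ae_pMinusOn_le {n : ℕ} {p : Rn n → ℝ} (hp1 : ∀ x, 1 ≤ p x) (Q : Cube n) :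
    ∀ᵐ x ∂(volume.restrict Q.toSet), pMinusOn p Q ≤ p x :=
  ae_essInf_le (Filter.isBoundedUnder_of ⟨1, hp1⟩)

theorem le_pMinusOn {n : ℕ} {p : Rn n → ℝ} {b c : ℝ} (hb : ∀ᵐ x, p x ≤ b) (Q : Cube n)
    (hc : ∀ x ∈ Q.toSet, c ≤ p x) : c ≤ pMinusOn p Q := by
  have : (ae ((volume : Measure (Rn n)).restrict Q.toSet)).NeBot :=
    ae_neBot.2 Q.restrict_ne_zero
  refine le_essInf_of_ae_le c (ae_restrict_of_forall_mem Q.measurableSet_toSet hc) ?_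
  exact Filter.IsBoundedUnder.isCoboundedUnder_ge ⟨b, ae_restrict_of_ae hb⟩

theorem inv_pMinusOn_sub_mul_log_le {n : ℕ} {p : Rn n → ℝ} {b K : ℝ} (hp1 : ∀ x, 1 ≤ p x)
    (hb : ∀ᵐ x, p x ≤ b) (Q : Cube n) {x : Rn n} {T : ℝ} (hT : 0 < T)
    (hosc : ∀ y ∈ Q.toSet, |1 / p x - 1 / p y| * T ≤ K) :
    ((pMinusOn p Q)⁻¹ - 1 / p x) * T ≤ K := by
  have hpos : ∀ y, 0 < p y := fun y => one_pos.trans_le (hp1 y)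
  have hy : ∀ y ∈ Q.toSet, 1 / p y ≤ 1 / p x + K / T := by
    intro y hy
    have h1 := hosc y hy
    rw [← le_div_iff₀ hT] at h1
    have := neg_abs_le (1 / p x - 1 / p y)
    linarith
  have hbase : Q.base ∈ Q.toSet := fun i => ⟨le_rfl, by linarith [Q.side_pos]⟩
  have hr : 0 < 1 / p x + K / T := (one_div_pos.2 (hpos Q.base)).trans_le (hy _ hbase)
  have h2 : (1 / p x + K / T)⁻¹ ≤ pMinusOn p Q := by
    refine le_pMinusOn hb Q fun y hyQ => ?_
    rw [inv_le_comm₀ hr (hpos y), ← one_div]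
    exact hy y hyQ
  have h3 : (pMinusOn p Q)⁻¹ ≤ 1 / p x + K / T :=
    inv_le_of_inv_le₀ hr h2
  rw [← le_div_iff₀ hT]
  linarith

theorem half_le_of_one_div_eq {a b c : ℝ} (ha : 1 ≤ a) (hb : 1 ≤ b) (h : 1 / c = 1 / a + 1 / b) :
    1 / 2 ≤ c := by
  have h1 : 1 / a ≤ 1 := by rw [div_le_one (by linarith)]; exact ha
  have h2 : 1 / b ≤ 1 := by rw [div_le_one (by linarith)]; exact hb
  have h3 : 0 < 1 / a := by positivity
  have h4 : 0 < 1 / b := by positivity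
  have hc : 0 < c := one_div_pos.1 (h ▸ add_pos h3 h4)
  rw [div_le_comm₀ two_pos hc]
  linarith

/-- Quantitative lower bound for `‖w₁⁻¹ χ_Q‖` in terms of the relative size of `Q` in its hull
with the unit cube. -/
theorem ApVec.exists_ofReal_le_vNorm {n : ℕ} {p₁ p₂ p w₁ w₂ w : Rn n → ℝ}
    (hp₁m : Measurable p₁) (hp₂m : Measurable p₂)
    (hp₁1 : ∀ᵐ x, 1 < p₁ x) (hp₂1 : ∀ᵐ x, 1 < p₂ x)
    (hp : ∀ x, 1 / p x = 1 / p₁ x + 1 / p₂ x)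
    (hw₁ : IsWeight w₁) (hw₂ : IsWeight w₂) (hw : ∀ x, w x = w₁ x * w₂ x)
    (hA : ApVec p₁ p₂ p w₁ w₂ w) :
    ∃ κ : ℝ, 0 < κ ∧ κ ≤ 1 ∧ ∀ Q : Cube n,
      ENNReal.ofReal (κ * (Q.side / Q.hull.side) ^ (2 * n)) ≤
        vNorm (conjExp p₁) (Q.toSet.indicator fun y => (w₁ y)⁻¹) := by
  obtain ⟨C, hC, hA⟩ := hA
  have hpm : Measurable p := by
    have : p = fun x => (1 / p₁ x + 1 / p₂ x)⁻¹ := by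
      funext x
      rw [← hp x, one_div, inv_inv]
    rw [this]
    fun_prop
  have hwm : Measurable w := by
    rw [funext hw]
    exact hw₁.1.mul hw₂.1
  have conj_half : ∀ {s : Rn n → ℝ}, (∀ᵐ x, 1 < s x) → ∀ᵐ x, 1 / 2 ≤ (conjExp s x).toReal := by
    intro s hs
    filter_upwards [hs] with x hx
    rw [toReal_conjExp_of_one_lt hx, le_div_iff₀ (by linarith)]
    linarith
  have conj_top : ∀ {s : Rn n → ℝ}, (∀ᵐ x, 1 < s x) → ∀ᵐ x, conjExp s x ≠ ∞ := by
    intro s hs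
    filter_upwards [hs] with x hx
    rw [conjExp_of_one_lt hx]
    exact ENNReal.ofReal_ne_top
  have inv_ne : ∀ {v : Rn n → ℝ}, IsWeight v → ∀ᵐ x, (v x)⁻¹ ≠ 0 := by
    intro v hv
    filter_upwards [hv.2] with x hx
    exact inv_ne_zero hx.ne'
  have hp_half : ∀ᵐ x, 1 / 2 ≤ (ofExp p x).toReal := by
    filter_upwards [hp₁1, hp₂1] with x h1 h2
    have := half_le_of_one_div_eq h1.le h2.le (hp x)
    rwa [ofExp, ENNReal.toReal_ofReal (by linarith)]
  have hp_top : ∀ᵐ x, ofExp p x ≠ ∞ := ae_of_all _ fun _ => ENNReal.ofReal_ne_top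
  have hw0 : ∀ᵐ x, w x ≠ 0 := by
    filter_upwards [hw₁.2, hw₂.2] with x h1 h2
    rw [hw x]
    positivity
  set N₁ : Cube n → ℝ≥0∞ := fun Q => vNorm (conjExp p₁) (Q.toSet.indicator fun y => (w₁ y)⁻¹)
  set N₂ : Cube n → ℝ≥0∞ := fun Q => vNorm (conjExp p₂) (Q.toSet.indicator fun y => (w₂ y)⁻¹)
  set N : Cube n → ℝ≥0∞ := fun Q => vNorm (ofExp p) (Q.toSet.indicator w)
  have hN₁ : ∀ Q, N₁ Q ≠ 0 := vNorm_indicator_ne_zero (measurable_conjExp hp₁m) (conj_top hp₁1)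
    (conj_half hp₁1) hw₁.1.inv (inv_ne hw₁)
  have hN₂ : ∀ Q, N₂ Q ≠ 0 := vNorm_indicator_ne_zero (measurable_conjExp hp₂m) (conj_top hp₂1)
    (conj_half hp₂1) hw₂.1.inv (inv_ne hw₂)
  have hN : ∀ Q, N Q ≠ 0 := vNorm_indicator_ne_zero hpm.ennreal_ofReal hp_top hp_half hwm hw0
  have pos : ∀ {r : Rn n → ℝ≥0∞}, (∀ᵐ x, 1 / 2 ≤ (r x).toReal) → ∀ᵐ x, 0 < (r x).toReal :=
    fun h => h.mono fun x hx => by linarith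
  have holder : ∀ Q : Cube n, Q.vol ^ 2 ≤ 9 * (N₁ Q * N Q * N₂ Q) := by
    intro Q
    refine vol_sq_le_vNorm_mul (measurable_conjExp hp₁m) hpm.ennreal_ofReal hw₁.1.inv hwm
      (conj_top hp₁1) hp_top (conj_top hp₂1) (pos (conj_half hp₁1)) (pos hp_half)
      (pos (conj_half hp₂1)) ?_ ?_ Q (hN₁ Q) (hN Q) (hN₂ Q)
    · filter_upwards [hp₁1, hp₂1] with x h1 h2
      have h3 := half_le_of_one_div_eq h1.le h2.le (hp x)
      rw [toReal_conjExp_of_one_lt h1, toReal_conjExp_of_one_lt h2,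
        ENNReal.toReal_ofReal (by linarith), hp x]
      have h4 : p₁ x ≠ 0 := by linarith
      have h5 : p₂ x ≠ 0 := by linarith
      field_simp
      ring
    · filter_upwards [hw₁.2, hw₂.2] with x h1 h2
      rw [hw x, Pi.inv_apply]
      field_simp
  have hAp : ∀ Q : Cube n, N Q * N₁ Q * N₂ Q ≤ C * Q.vol ^ 2 := by
    intro Q
    have h := hA Q
    have hv0 := Q.vol_ne_zero
    have hvt := Q.vol_ne_top
    rw [mul_assoc, mul_assoc, ← ENNReal.inv_pow, mul_comm, ← div_eq_mul_inv,
      ENNReal.div_le_iff (pow_ne_zero 2 hv0) (ENNReal.pow_ne_top hvt)] at h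
    rwa [mul_assoc]
  set c : ℝ≥0∞ := min (N₁ (Cube.unit n)) 1
  have hc0 : c ≠ 0 := (lt_min (pos_iff_ne_zero.2 (hN₁ _)) one_pos).ne'
  have hc1 : c ≤ 1 := min_le_right _ _
  have hct : c ≠ ∞ := (hc1.trans_lt one_lt_top).ne
  have hcpos : 0 < c.toReal := ENNReal.toReal_pos hc0 hct
  have hcone : c.toReal ≤ 1 := ENNReal.toReal_le_of_le_ofReal zero_le_one (by simpa using hc1)
  have hC0 : 0 ≤ C.toReal := ENNReal.toReal_nonneg
  have hmain : ∀ Q : Cube n, c * Q.vol ^ 2 ≤ N₁ Q * (9 * C * Q.hull.vol ^ 2) := by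
    intro Q
    have e1 : c ≤ N₁ Q.hull := (min_le_left _ _).trans (vNorm_indicator_mono _ _ Q.unit_subset_hull)
    have e2 : N Q ≤ N Q.hull := vNorm_indicator_mono _ _ Q.toSet_subset_hull
    have e3 : N₂ Q ≤ N₂ Q.hull := vNorm_indicator_mono _ _ Q.toSet_subset_hull
    calc c * Q.vol ^ 2 ≤ N₁ Q.hull * (9 * (N₁ Q * N Q.hull * N₂ Q.hull)) :=
          mul_le_mul' e1 ((holder Q).trans (by gcongr))
      _ = N₁ Q * (9 * (N Q.hull * N₁ Q.hull * N₂ Q.hull)) := by ring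
      _ ≤ N₁ Q * (9 * (C * Q.hull.vol ^ 2)) := by grw [hAp Q.hull]
      _ = _ := by ring
  refine ⟨c.toReal / (9 * (C.toReal + 1)), by positivity, ?_, fun Q => ?_⟩
  · rw [div_le_one (by positivity)]
    linarith
  have hs := Q.side_pos
  have hL := Q.hull.side_pos
  have hden : 0 < 9 * (C.toReal + 1) * (Q.hull.side ^ n) ^ 2 := by positivity
  have heq : c.toReal / (9 * (C.toReal + 1)) * (Q.side / Q.hull.side) ^ (2 * n) =
      c.toReal * (Q.side ^ n) ^ 2 / (9 * (C.toReal + 1) * (Q.hull.side ^ n) ^ 2) := by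
    rw [div_pow, mul_comm 2 n, pow_mul, pow_mul]
    field_simp
  rw [heq, ENNReal.ofReal_div_of_pos hden]
  refine ENNReal.div_le_of_le_mul ?_
  calc ENNReal.ofReal (c.toReal * (Q.side ^ n) ^ 2) = c * Q.vol ^ 2 := by
        rw [ENNReal.ofReal_mul hcpos.le, ENNReal.ofReal_toReal hct,
          ENNReal.ofReal_pow (by positivity), Cube.vol]
    _ ≤ N₁ Q * (9 * C * Q.hull.vol ^ 2) := hmain Q
    _ ≤ N₁ Q * ENNReal.ofReal (9 * (C.toReal + 1) * (Q.hull.side ^ n) ^ 2) := by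
        gcongr
        rw [ENNReal.ofReal_mul (by positivity), ENNReal.ofReal_pow (by positivity), Cube.vol]
        gcongr
        rw [ENNReal.ofReal_mul (by positivity), ENNReal.ofReal_add hC0 zero_le_one,
          ENNReal.ofReal_toReal hC]
        simp only [ENNReal.ofReal_ofNat, ENNReal.ofReal_one]
        gcongr
        exact le_self_add

theorem ENNReal.rpow_neg_le_of_ofReal_le {N : ℝ≥0∞} {v t B : ℝ} (hv : 0 < v) (ht : 0 ≤ t)
    (hN : ENNReal.ofReal v ≤ N) (hB : t * -Real.log v ≤ B) :
    N ^ (-t) ≤ ENNReal.ofReal (Real.exp B) := by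
  calc N ^ (-t) ≤ ENNReal.ofReal v ^ (-t) := by
        rw [ENNReal.rpow_neg, ENNReal.rpow_neg, ENNReal.inv_le_inv]
        exact ENNReal.rpow_le_rpow hN ht
    _ = ENNReal.ofReal (v ^ (-t)) := ENNReal.ofReal_rpow_of_pos hv
    _ ≤ ENNReal.ofReal (Real.exp B) := by
        refine ENNReal.ofReal_le_ofReal ?_
        rw [Real.rpow_def_of_pos hv]
        exact Real.exp_le_exp.2 (by linarith)

/-- The estimate for the first weight. -/
theorem ApVec.exists_vNorm_rpow_le {n : ℕ} {p₁ p₂ p w₁ w₂ w : Rn n → ℝ}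
    (hp₁m : Measurable p₁) (hp₂m : Measurable p₂)
    (hp₁1 : ∀ x, 1 ≤ p₁ x) (hp₂1 : ∀ x, 1 ≤ p₂ x)
    (hp₁b : ∃ a b : ℝ, 1 < a ∧ ∀ᵐ x ∂(volume : Measure (Rn n)), a ≤ p₁ x ∧ p₁ x ≤ b)
    (hp₂b : ∃ a b : ℝ, 1 < a ∧ ∀ᵐ x ∂(volume : Measure (Rn n)), a ≤ p₂ x ∧ p₂ x ≤ b)
    (hp₁LH : LH p₁) (hp₂LH : LH p₂)
    (hp : ∀ x, 1 / p x = 1 / p₁ x + 1 / p₂ x)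
    (hw₁ : IsWeight w₁) (hw₂ : IsWeight w₂) (hw : ∀ x, w x = w₁ x * w₂ x)
    (hA : ApVec p₁ p₂ p w₁ w₂ w) :
    ∃ C : ℝ≥0∞, C ≠ ∞ ∧ ∀ Q : Cube n, ∀ᵐ x ∂(volume.restrict Q.toSet),
      vNorm (conjExp p₁) (Q.toSet.indicator fun y => (w₁ y)⁻¹) ^ (qExp p₁ p₂ Q - p x) ≤ C := by
  obtain ⟨a₁, b₁, ha₁, hb₁⟩ := hp₁b
  obtain ⟨a₂, b₂, ha₂, hb₂⟩ := hp₂b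
  obtain ⟨κ, hκ0, hκ1, hκ⟩ := hA.exists_ofReal_le_vNorm hp₁m hp₂m
    (hb₁.mono fun x hx => ha₁.trans_le hx.1) (hb₂.mono fun x hx => ha₂.trans_le hx.1)
    hp hw₁ hw₂ hw
  obtain ⟨K₁, -, hK₁⟩ := hp₁LH.exists_osc_mul_log_le hp₁1
  obtain ⟨K₂, -, hK₂⟩ := hp₂LH.exists_osc_mul_log_le hp₂1
  refine ⟨ENNReal.ofReal (Real.exp (b₁ * -Real.log κ + 2 * n * (b₁ ^ 2 * (K₁ + K₂)))),
    ENNReal.ofReal_ne_top, fun Q => ?_⟩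
  filter_upwards [ae_pMinusOn_le hp₁1 Q, ae_pMinusOn_le hp₂1 Q, ae_restrict_of_ae hb₁,
    ae_restrict_mem Q.measurableSet_toSet] with x hm₁ hm₂ hxb hxQ
  have hone₁ : 1 ≤ pMinusOn p₁ Q := le_pMinusOn (hb₁.mono fun x hx => hx.2) Q fun x _ => hp₁1 x
  have hone₂ : 1 ≤ pMinusOn p₂ Q := le_pMinusOn (hb₂.mono fun x hx => hx.2) Q fun x _ => hp₂1 x
  have hs := Q.side_pos
  have hL := Q.hull.side_pos
  set T := Real.log (Q.hull.side / Q.side) with hT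
  have hT0 : 0 < T := by
    refine Real.log_pos ?_
    rw [one_lt_div hs]
    have : Q.hull.side = 2 * (‖Q.base‖ + Q.side + 1) := rfl
    linarith [norm_nonneg Q.base]
  have hd₁ := inv_pMinusOn_sub_mul_log_le hp₁1 (hb₁.mono fun x hx => hx.2) Q hT0 (hK₁ Q x hxQ)
  have hd₂ := inv_pMinusOn_sub_mul_log_le hp₂1 (hb₂.mono fun x hx => hx.2) Q hT0 (hK₂ Q x hxQ)
  have hx₁ : 0 < p₁ x := one_pos.trans_le (hp₁1 x)
  have hx₂ : 0 < p₂ x := one_pos.trans_le (hp₂1 x)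
  have hb0 : 0 < b₁ := hx₁.trans_le hxb.2
  set u := 1 / p₁ x + 1 / p₂ x with hu
  set v := (pMinusOn p₁ Q)⁻¹ + (pMinusOn p₂ Q)⁻¹ with hv
  have hbu : b₁⁻¹ ≤ u := by
    have h1 : b₁⁻¹ ≤ 1 / p₁ x := by rw [one_div]; exact inv_anti₀ hx₁ hxb.2
    have h2 : 0 < 1 / p₂ x := by positivity
    linarith
  have huv : u ≤ v := by
    have h1 : 1 / p₁ x ≤ (pMinusOn p₁ Q)⁻¹ := by rw [one_div]; exact inv_anti₀ (by linarith) hm₁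
    have h2 : 1 / p₂ x ≤ (pMinusOn p₂ Q)⁻¹ := by rw [one_div]; exact inv_anti₀ (by linarith) hm₂
    linarith
  have hu0 : 0 < u := (inv_pos.2 hb0).trans_le hbu
  have hv0 : 0 < v := hu0.trans_le huv
  have hpx : p x = u⁻¹ := by rw [hu, ← hp x, one_div, inv_inv]
  have hq : qExp p₁ p₂ Q = v⁻¹ := rfl
  have hub : u⁻¹ ≤ b₁ := inv_le_of_inv_le₀ hb0 hbu
  have hvu : v⁻¹ ≤ u⁻¹ := inv_anti₀ hu0 huv
  have hvpos : 0 < v⁻¹ := inv_pos.2 hv0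
  rw [hpx, hq, ← neg_sub]
  have hdiff : u⁻¹ - v⁻¹ ≤ b₁ ^ 2 * (v - u) := by
    have : u⁻¹ - v⁻¹ = u⁻¹ * v⁻¹ * (v - u) := by field_simp
    rw [this, sq]
    exact mul_le_mul_of_nonneg_right
      (mul_le_mul hub (hvu.trans hub) hvpos.le hb0.le) (by linarith)
  refine ENNReal.rpow_neg_le_of_ofReal_le (by positivity) (by linarith) (hκ Q) ?_
  have hlog : -Real.log (κ * (Q.side / Q.hull.side) ^ (2 * n)) = -Real.log κ + 2 * n * T := by
    rw [Real.log_mul hκ0.ne' (by positivity), Real.log_pow, hT, ← inv_div Q.hull.side,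
      Real.log_inv]
    push_cast
    ring
  have hκlog : 0 ≤ -Real.log κ := by linarith [Real.log_nonpos hκ0.le hκ1]
  have hTdiff : (u⁻¹ - v⁻¹) * T ≤ b₁ ^ 2 * (K₁ + K₂) := by
    calc (u⁻¹ - v⁻¹) * T ≤ b₁ ^ 2 * (v - u) * T := by gcongr
      _ = b₁ ^ 2 * (((pMinusOn p₁ Q)⁻¹ - 1 / p₁ x) * T + ((pMinusOn p₂ Q)⁻¹ - 1 / p₂ x) * T) := by
        rw [hu, hv]; ring
      _ ≤ _ := by gcongr
  rw [hlog]
  calc (u⁻¹ - v⁻¹) * (-Real.log κ + 2 * n * T)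
      = (u⁻¹ - v⁻¹) * -Real.log κ + 2 * n * ((u⁻¹ - v⁻¹) * T) := by ring
    _ ≤ _ := by
      gcongr
      linarith

/-- the estimate `‖wₗ^{-1}χ_Q‖_{pₗ'(·)}^{q(Q)-p(x)} ≲ 1`
for `l = 1,2`, uniformly over cubes `Q` and a.e. `x ∈ Q`. -/
theorem statement16 {n : ℕ} (p₁ p₂ p w₁ w₂ w : Rn n → ℝ)
    (hp₁m : Measurable p₁) (hp₂m : Measurable p₂)
    (hp₁1 : ∀ x, 1 ≤ p₁ x) (hp₂1 : ∀ x, 1 ≤ p₂ x)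
    (hp₁b : ∃ a b : ℝ, 1 < a ∧ ∀ᵐ x ∂(volume : Measure (Rn n)), a ≤ p₁ x ∧ p₁ x ≤ b)
    (hp₂b : ∃ a b : ℝ, 1 < a ∧ ∀ᵐ x ∂(volume : Measure (Rn n)), a ≤ p₂ x ∧ p₂ x ≤ b)
    (hp₁LH : LH p₁) (hp₂LH : LH p₂)
    (hp : ∀ x, 1 / p x = 1 / p₁ x + 1 / p₂ x)
    (hw₁ : IsWeight w₁) (hw₂ : IsWeight w₂)
    (hw : ∀ x, w x = w₁ x * w₂ x)
    (hA : ApVec p₁ p₂ p w₁ w₂ w) :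
    ∃ C : ℝ≥0∞, C ≠ ∞ ∧ ∀ Q : Cube n,
      ∀ᵐ x ∂(volume.restrict Q.toSet),
        vNorm (conjExp p₁) (Q.toSet.indicator fun y => (w₁ y)⁻¹) ^ (qExp p₁ p₂ Q - p x)
            ≤ C ∧
          vNorm (conjExp p₂) (Q.toSet.indicator fun y => (w₂ y)⁻¹) ^ (qExp p₁ p₂ Q - p x)
            ≤ C := by
  obtain ⟨C₁, hC₁, h₁⟩ := hA.exists_vNorm_rpow_le hp₁m hp₂m hp₁1 hp₂1 hp₁b hp₂b hp₁LH hp₂LH hp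
    hw₁ hw₂ hw
  have hA' : ApVec p₂ p₁ p w₂ w₁ w := by
    obtain ⟨C, hC, h⟩ := hA
    exact ⟨C, hC, fun Q => by rw [mul_right_comm]; exact h Q⟩
  obtain ⟨C₂, hC₂, h₂⟩ := hA'.exists_vNorm_rpow_le hp₂m hp₁m hp₂1 hp₁1 hp₂b hp₁b hp₂LH hp₁LH
    (fun x => (hp x).trans (add_comm _ _)) hw₂ hw₁ (fun x => (hw x).trans (mul_comm _ _))
  refine ⟨max C₁ C₂, by simp [hC₁, hC₂], fun Q => ?_⟩
  have hq : qExp p₁ p₂ Q = qExp p₂ p₁ Q := by rw [qExp, qExp, add_comm]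
  filter_upwards [h₁ Q, h₂ Q] with x hx₁ hx₂
  refine ⟨hx₁.trans (le_max_left _ _), ?_⟩
  rw [hq]
  exact hx₂.trans (le_max_right _ _)
end
end

section
/- Let p₁(·) : ℝⁿ → [1,∞) satisfy 1 < (p₁)₋ ≤ (p₁)₊ < ∞ and p₁(·) ∈ LH with asymptotic value (p₁)∞, let w₁ be a weight with w₁^{−1/2} ∈ A_{2p₁'(·)}, and set σ₁(x) = w₁(x)^{−p₁'(x)}. Then there is a constant C such that for every cube Q with σ₁(Q) ≥ 1 and every nonnegative measurable f, σ₁(Q)^{−1}∫_Q f σ₁ dy ≤ C·‖f‖_{L^{p₁(·)}_{σ₁}}, where ‖f‖_{L^{p₁(·)}_{σ₁}} := inf{λ > 0 : ∫(|f(x)|/λ)^{p₁(x)}σ₁(x) dx ≤ 1}. -/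
open MeasureTheory ENNReal Set

noncomputable section

theorem ENNReal.le_rpow_add_one {t : ℝ≥0∞} {p : ℝ} (hp : 1 ≤ p) : t ≤ t ^ p + 1 := by
  rcases le_total t 1 with h | h
  · exact h.trans le_add_self
  · calc t = t ^ (1 : ℝ) := (ENNReal.rpow_one t).symm
      _ ≤ t ^ p := ENNReal.rpow_le_rpow_of_exponent_le h hp
      _ ≤ t ^ p + 1 := le_self_add

/-- If `ν` is a measure and `p(·) ≥ 1`, the integral of `f` over a set of measure at least `1` is
at most `2 ν(s)` times any `lam` admissible for the norm of `f` in `L^{p(·)}(ν)`. -/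
theorem setLIntegral_le_mul_of_eModular_le_one {n : ℕ} {p : Rn n → ℝ} (hp : ∀ x, 1 ≤ p x)
    {ν : Measure (Rn n)} {f : Rn n → ℝ≥0∞} {lam : ℝ≥0∞} (h0 : lam ≠ 0) (htop : lam ≠ ∞)
    (hmod : eModular (ofExp p) ν f lam ≤ 1) {s : Set (Rn n)} (hs : 1 ≤ ν s) :
    ∫⁻ x in s, f x ∂ν ≤ 2 * lam * ν s := by
  have hset : {x | ofExp p x ≠ ∞} = univ := by ext x; simp [ofExp]
  have hint : ∫⁻ x, (f x / lam) ^ p x ∂ν ≤ 1 := by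
    refine le_trans (le_of_eq ?_) (le_self_add.trans hmod)
    rw [hset, Measure.restrict_univ]
    refine lintegral_congr fun x => ?_
    rw [ofExp, ENNReal.toReal_ofReal (zero_le_one.trans (hp x))]
  calc ∫⁻ x in s, f x ∂ν ≤ ∫⁻ x in s, lam * ((f x / lam) ^ p x + 1) ∂ν := by
        refine lintegral_mono fun x => ?_
        calc f x = lam * (f x / lam) := (ENNReal.mul_div_cancel h0 htop).symm
          _ ≤ _ := by gcongr; exact ENNReal.le_rpow_add_one (hp x)
    _ = lam * (∫⁻ x in s, (f x / lam) ^ p x ∂ν + ν s) := by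
        rw [lintegral_const_mul' _ _ htop, lintegral_add_right _ measurable_const,
          setLIntegral_one]
    _ ≤ lam * (ν s + ν s) := by
        gcongr
        exact (setLIntegral_le_lintegral _ _).trans (hint.trans hs)
    _ = 2 * lam * ν s := by ring

/-- for `w₁^{-1/2} ∈ A_{2p₁'(·)}` and cubes with `σ₁(Q) ≥ 1`, the
`σ₁`-average of `f` over `Q` is controlled by `‖f‖_{L^{p₁(·)}_{σ₁}}`. -/
theorem statement17 {n : ℕ} (p₁ : Rn n → ℝ) (p₁inf : ℝ) (w₁ σ₁ : Rn n → ℝ)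
    (hp₁m : Measurable p₁)
    (hp₁1 : ∀ x, 1 ≤ p₁ x)
    (hp₁b : ∃ a b : ℝ, 1 < a ∧ ∀ᵐ x ∂(volume : Measure (Rn n)), a ≤ p₁ x ∧ p₁ x ≤ b)
    (hp₁LH : LH0 p₁ ∧ LHinfWith p₁ p₁inf)
    (hw₁ : IsWeight w₁)
    (hA : ApVarE (fun x => 2 * conjExp p₁ x) (fun x => w₁ x ^ (-(1 / 2) : ℝ)))
    (hσ₁ : ∀ x, σ₁ x = w₁ x ^ (-(p₁ x / (p₁ x - 1)))) :
    ∃ C : ℝ≥0∞, C ≠ ∞ ∧ ∀ Q : Cube n,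
      1 ≤ (∫⁻ y in Q.toSet, ENNReal.ofReal (σ₁ y)) →
      ∀ f : Rn n → ℝ, Measurable f → (∀ x, 0 ≤ f x) →
        (∫⁻ y in Q.toSet, ENNReal.ofReal (σ₁ y))⁻¹ *
            (∫⁻ y in Q.toSet, ENNReal.ofReal (f y * σ₁ y)) ≤
          C * eNorm (ofExp p₁) (volume.withDensity fun x => ENNReal.ofReal (σ₁ x))
                (fun x => ENNReal.ofReal (f x)) := by
  have hσm : Measurable fun x => ENNReal.ofReal (σ₁ x) := by
    rw [funext hσ₁]
    exact (hw₁.1.pow (hp₁m.div (hp₁m.sub_const 1)).neg).ennreal_ofReal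
  refine ⟨2, ENNReal.ofNat_ne_top, fun Q hQ f hf hf0 => ?_⟩
  have hmeas := Q.measurableSet_toSet
  set ν := (volume : Measure (Rn n)).withDensity fun x => ENNReal.ofReal (σ₁ x) with hν
  have hνQ : ν Q.toSet = ∫⁻ y in Q.toSet, ENNReal.ofReal (σ₁ y) := withDensity_apply _ hmeas
  have hfσ : ∫⁻ y in Q.toSet, ENNReal.ofReal (f y * σ₁ y)
      = ∫⁻ y in Q.toSet, ENNReal.ofReal (f y) ∂ν := by
    rw [hν, setLIntegral_withDensity_eq_setLIntegral_mul _ hσm hf.ennreal_ofReal hmeas]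
    refine lintegral_congr fun y => ?_
    rw [Pi.mul_apply, ENNReal.ofReal_mul (hf0 y), mul_comm]
  rw [hfσ, ← hνQ]
  rw [← hνQ] at hQ
  refine (ENNReal.div_le_iff' two_ne_zero ENNReal.ofNat_ne_top).1 (le_sInf ?_)
  rintro lam ⟨h0, hmod⟩
  rw [ENNReal.div_le_iff' two_ne_zero ENNReal.ofNat_ne_top]
  rcases eq_or_ne lam ∞ with rfl | htop
  · simp
  rw [mul_comm, ← div_eq_mul_inv]
  exact ENNReal.div_le_of_le_mul (setLIntegral_le_mul_of_eModular_le_one hp₁1 h0 htop hmod hQ)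
end
end

section
/- Let p(·) : ℝⁿ → [1,∞) be a log-Hölder continuous exponent (p(·) ∈ LH) with p₊ < ∞, and assume p is continuous. Then there is a constant C depending only on p(·) and n such that for every cube Q with dist(Q,0) ≥ ℓ(Q) (where ℓ(Q) is the side length of Q) and every x ∈ Q, 0 ≤ p₊(Q) − p(x) ≤ C/log(e+|x|), where p₊(Q) = sup_{y∈Q} p(y). -/
open MeasureTheory ENNReal Set

noncomputable section

/-- Points of a cube are at distance at most the side length. -/
lemma Cube.dist_le_side {n : ℕ} (Q : Cube n) {x y : Rn n} (hx : x ∈ Q.toSet)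
    (hy : y ∈ Q.toSet) : dist x y ≤ Q.side := by
  refine (dist_pi_le_iff Q.side_pos.le).2 fun i => ?_
  rw [Real.dist_eq, abs_le]
  have hxi := hx i
  have hyi := hy i
  constructor <;> linarith

/-- In a cube far from the origin, any two points have norms comparable with constant `2`. -/
lemma Cube.norm_le_two_mul_norm {n : ℕ} (Q : Cube n)
    (hQ : Q.side ≤ Metric.infDist 0 Q.toSet) {x y : Rn n} (hx : x ∈ Q.toSet)
    (hy : y ∈ Q.toSet) : ‖x‖ ≤ 2 * ‖y‖ := by
  have hside : Q.side ≤ ‖y‖ := by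
    simpa using hQ.trans (Metric.infDist_le_dist_of_mem hy)
  have hdist := Q.dist_le_side hx hy
  have htri := norm_le_norm_add_norm_sub' x y
  rw [← dist_eq_norm] at htri
  linarith

lemma log_exp_one_add_pos {t : ℝ} (ht : 0 ≤ t) : 0 < Real.log (Real.exp 1 + t) :=
  Real.log_pos (by linarith [Real.add_one_le_exp (1 : ℝ)])

lemma log_exp_one_add_le_two_mul {s t : ℝ} (hs : 0 ≤ s) (ht : 0 ≤ t) (hst : s ≤ 2 * t) :
    Real.log (Real.exp 1 + s) ≤ 2 * Real.log (Real.exp 1 + t) := by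
  have he := Real.add_one_le_exp (1 : ℝ)
  have hsq : 2 * Real.log (Real.exp 1 + t) = Real.log ((Real.exp 1 + t) ^ 2) := by
    simp [Real.log_pow]
  rw [hsq]
  exact Real.log_le_log (by linarith) (by nlinarith)

/-- Oscillation of a bounded exponent in `LH∞` between two points of comparable norm. -/
lemma sub_le_div_log_of_norm_le {n : ℕ} {p : Rn n → ℝ} {pinf B C : ℝ} (h1 : ∀ x, 1 ≤ p x)
    (hB : ∀ x, p x ≤ B) (hC : 0 ≤ C)
    (hp : ∀ x : Rn n, |1 / p x - 1 / pinf| ≤ C / Real.log (Real.exp 1 + ‖x‖))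
    {x y : Rn n} (hxy : ‖x‖ ≤ 2 * ‖y‖) :
    p y - p x ≤ 3 * B ^ 2 * C / Real.log (Real.exp 1 + ‖x‖) := by
  have hLx := log_exp_one_add_pos (norm_nonneg x)
  have hLy := log_exp_one_add_pos (norm_nonneg y)
  have hcomp : C / Real.log (Real.exp 1 + ‖y‖) ≤ 2 * C / Real.log (Real.exp 1 + ‖x‖) := by
    rw [div_le_div_iff₀ hLy hLx]
    nlinarith [log_exp_one_add_le_two_mul (norm_nonneg x) (norm_nonneg y) hxy]
  have hrecip : 1 / p x - 1 / p y ≤ 3 * C / Real.log (Real.exp 1 + ‖x‖) := by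
    have hx := (abs_le.1 (hp x)).2
    have hy := (abs_le.1 (hp y)).1
    have hsum : 3 * C / Real.log (Real.exp 1 + ‖x‖) =
        C / Real.log (Real.exp 1 + ‖x‖) + 2 * C / Real.log (Real.exp 1 + ‖x‖) := by ring
    linarith
  have hpx := h1 x
  have hpy := h1 y
  have hprod : p x * p y ≤ B ^ 2 := by nlinarith [hB x, hB y]
  calc p y - p x = p x * p y * (1 / p x - 1 / p y) := by field_simp
    _ ≤ p x * p y * (3 * C / Real.log (Real.exp 1 + ‖x‖)) :=
      mul_le_mul_of_nonneg_left hrecip (by positivity)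
    _ ≤ B ^ 2 * (3 * C / Real.log (Real.exp 1 + ‖x‖)) :=
      mul_le_mul_of_nonneg_right hprod (by positivity)
    _ = 3 * B ^ 2 * C / Real.log (Real.exp 1 + ‖x‖) := by ring

/-- for a continuous log-Hölder exponent with `p₊ < ∞` and a cube `Q`
with `dist(Q,0) ≥ ℓ(Q)`, one has `0 ≤ p₊(Q) − p(x) ≤ C/log(e+|x|)` for `x ∈ Q`. -/
theorem statement19 {n : ℕ} (p : Rn n → ℝ)
    (hc : Continuous p) (h1 : ∀ x, 1 ≤ p x)
    (hub : ∃ B : ℝ, ∀ x, p x ≤ B)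
    (hLH : LH p) :
    ∃ C > (0 : ℝ), ∀ Q : Cube n, Q.side ≤ Metric.infDist 0 Q.toSet →
      ∀ x ∈ Q.toSet,
        0 ≤ sSup (p '' Q.toSet) - p x ∧
          sSup (p '' Q.toSet) - p x ≤ C / Real.log (Real.exp 1 + ‖x‖) := by
  obtain ⟨B, hB⟩ := hub
  obtain ⟨-, pinf, -, C, hC, hp⟩ := hLH
  have hBpos : 0 < B := by linarith [h1 0, hB 0]
  refine ⟨3 * B ^ 2 * C, by positivity, fun Q hQ x hx => ⟨?_, ?_⟩⟩
  · have hbdd : BddAbove (p '' Q.toSet) := ⟨B, by rintro _ ⟨y, -, rfl⟩; exact hB y⟩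
    exact sub_nonneg.2 (le_csSup hbdd ⟨x, hx, rfl⟩)
  · rw [sub_le_iff_le_add]
    refine csSup_le ⟨_, x, hx, rfl⟩ ?_
    rintro _ ⟨y, hy, rfl⟩
    exact sub_le_iff_le_add.1
      (sub_le_div_log_of_norm_le h1 hB hC.le hp (Q.norm_le_two_mul_norm hQ hx hy))
end
end
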